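/- arXiv:2209.05148 — 5 statements merged into one kernel-verified Lean document; each statement's English description precedes it below -/
import Mathlib

section
/- Suppose p_A ∈ (0,1) satisfies A(p_A) ≤ A(p) for all p ∈ (0,1). Then p* := max{p_e, p_A} minimizes γ over (0,1): for every p ∈ (0,1), γ(p*) ≤ γ(p). -/
/-- Difference of two values of `x ↦ a / x + b / (1 - x)`. -/
theorem div_add_div_one_sub_sub {a b x z : ℝ} (hx : x ∈ Set.Ioo (0 : ℝ) 1)
    (hz : z ∈ Set.Ioo (0 : ℝ) 1) :
    (a / z + b / (1 - z)) - (a / x + b / (1 - x)) =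
      (z - x) * (b * (x * z) - a * ((1 - x) * (1 - z))) / (x * z * ((1 - x) * (1 - z))) := by
  have h1 := hx.1.ne'
  have h2 := hz.1.ne'
  have h3 := (sub_pos.2 hx.2).ne'
  have h4 := (sub_pos.2 hz.2).ne'
  field_simp
  ring

/-- Comparison of two values of `x ↦ a / x + b / (1 - x)`. -/
theorem div_add_div_one_sub_le_iff {a b x z : ℝ} (hx : x ∈ Set.Ioo (0 : ℝ) 1)
    (hz : z ∈ Set.Ioo (0 : ℝ) 1) (hxz : x < z) :
    a / x + b / (1 - x) ≤ a / z + b / (1 - z) ↔ a * ((1 - x) * (1 - z)) ≤ b * (x * z) := by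
  have h1 := hx.1
  have h2 := hz.1
  have h3 := sub_pos.2 hx.2
  have h4 := sub_pos.2 hz.2
  have h5 := sub_pos.2 hxz
  rw [← sub_nonneg, div_add_div_one_sub_sub hx hz, le_div_iff₀ (by positivity), zero_mul,
    mul_nonneg_iff_of_pos_left h5, sub_nonneg]

/-- To the right of a point with a smaller value, `x ↦ a / x + b / (1 - x)` increases. -/
theorem div_add_div_one_sub_le_of_le {a b x y z : ℝ} (ha : 0 ≤ a) (hb : 0 ≤ b)
    (hx : 0 < x) (hxy : x ≤ y) (hyz : y ≤ z) (hz : z < 1)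
    (h : a / x + b / (1 - x) ≤ a / z + b / (1 - z)) :
    a / y + b / (1 - y) ≤ a / z + b / (1 - z) := by
  rcases hyz.eq_or_lt with rfl | hyz
  · rfl
  have hz0 : 0 < z := by linarith
  have hz1 : 0 < 1 - z := by linarith
  rw [div_add_div_one_sub_le_iff ⟨hx, by linarith⟩ ⟨hz0, hz⟩ (by linarith)] at h
  rw [div_add_div_one_sub_le_iff ⟨by linarith, by linarith⟩ ⟨hz0, hz⟩ hyz]
  calc a * ((1 - y) * (1 - z)) ≤ a * ((1 - x) * (1 - z)) := by gcongr
    _ ≤ b * (x * z) := h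
    _ ≤ b * (y * z) := by gcongr

/-- The smaller root of `3 l p² - (7 l + L) p + 4 l` lies in `(0, 1)`. -/
theorem crossing_root_spec {l L e : ℝ} (hl : 0 < l) (hL : 0 < L)
    (he : e = (7 * l + L - Real.sqrt (l ^ 2 + 14 * l * L + L ^ 2)) / (6 * l)) :
    e ∈ Set.Ioo (0 : ℝ) 1 ∧ L * e = l * (4 - 3 * e) * (1 - e) := by
  have hs := Real.sq_sqrt (show 0 ≤ l ^ 2 + 14 * l * L + L ^ 2 by positivity)
  have hs0 := Real.sqrt_nonneg (l ^ 2 + 14 * l * L + L ^ 2)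
  set s := Real.sqrt (l ^ 2 + 14 * l * L + L ^ 2)
  have hlL := mul_pos hl hL
  have h1 : s < 7 * l + L := by nlinarith
  have h2 : l + L < s := by nlinarith
  rw [eq_div_iff (by positivity)] at he
  have hse : s = 7 * l + L - 6 * l * e := by linarith
  refine ⟨⟨by nlinarith, by nlinarith⟩, ?_⟩
  rw [hse] at hs
  refine mul_left_cancel₀ (show 12 * l ≠ 0 by positivity) ?_
  linear_combination -hs

/-- To the right of the crossing point the first term of the maximum dominates. -/
theorem mul_four_div_sub_three_le {l L e p : ℝ} (hl : 0 < l) (hL : 0 < L) (he0 : 0 < e)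
    (he : L * e = l * (4 - 3 * e) * (1 - e)) (hep : e ≤ p) (hp : p < 1) :
    l * (4 / p - 3) ≤ L / (1 - p) := by
  have hp0 : 0 < p := by linarith
  rw [le_div_iff₀ (by linarith), show l * (4 / p - 3) * (1 - p) =
    l * (4 - 3 * p) * (1 - p) / p by field_simp, div_le_iff₀ hp0]
  have h1 : (4 - 3 * p) * (1 - p) ≤ (4 - 3 * e) * (1 - e) := by
    apply mul_le_mul <;> linarith
  nlinarith [mul_le_mul_of_nonneg_left h1 hl.le, mul_le_mul_of_nonneg_left hep hL.le]

/-- **Theorem 3, optimal rate.**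
Fix `λ > 0`, `L > 0`, `α > 0` and an integer `n ≥ 1`. With
`γ(p) = αλ²(1−p)/(2n²p) + max{ L/(n(1−p)), (λ/n)(1 + 4(1−p)/p) }`,
`A(p) = αλ²/(2n²p) + L/(n(1−p))`, and
`p_e = (7λ + L − √(λ² + 14λL + L²))/(6λ)`:
if `p_A ∈ (0,1)` minimizes `A` over `(0,1)`, then `p* = max{p_e, p_A}` minimizes `γ`
over `(0,1)`. -/
theorem stmt2 (lam L alpha : ℝ) (n : ℕ)
    (hlam : 0 < lam) (hL : 0 < L) (halpha : 0 < alpha) (hn : 1 ≤ n)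
    (γ A : ℝ → ℝ)
    (hγ : ∀ p, γ p = alpha * lam ^ 2 * (1 - p) / (2 * (n : ℝ) ^ 2 * p)
        + max (L / (n * (1 - p))) (lam / n * (1 + 4 * (1 - p) / p)))
    (hA : ∀ p, A p = alpha * lam ^ 2 / (2 * (n : ℝ) ^ 2 * p) + L / (n * (1 - p)))
    (pe : ℝ)
    (hpe : pe = (7 * lam + L - Real.sqrt (lam ^ 2 + 14 * lam * L + L ^ 2)) / (6 * lam))
    (pA : ℝ) (hpA : pA ∈ Set.Ioo (0 : ℝ) 1)
    (hpAmin : ∀ p ∈ Set.Ioo (0 : ℝ) 1, A pA ≤ A p) :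
    ∀ p ∈ Set.Ioo (0 : ℝ) 1, γ (max pe pA) ≤ γ p := by
  intro p hp
  obtain ⟨⟨he0, he1⟩, heq⟩ := crossing_root_spec hlam hL hpe
  have hn0 : (0 : ℝ) < n := by exact_mod_cast hn
  set a : ℝ := alpha * lam ^ 2 / (2 * (n : ℝ) ^ 2) with ha
  have ha0 : 0 < a := by positivity
  have hA' : ∀ q, A q = a / q + L / n / (1 - q) := fun q => by
    rw [hA, ha, div_div, div_div]
  have hγ' : ∀ q ∈ Set.Ioo (0 : ℝ) 1,
      γ q = max (A q) (a / q + lam / n * (4 / q - 3)) - a := by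
    intro q hq
    have h1 : alpha * lam ^ 2 * (1 - q) / (2 * (n : ℝ) ^ 2 * q) = a / q - a := by
      have := hq.1.ne'
      rw [ha]
      field_simp
    have h2 : 1 + 4 * (1 - q) / q = 4 / q - 3 := by
      have := hq.1.ne'
      field_simp
      ring
    rw [hγ, hA', h1, h2, ← div_div L, max_add_add_left]
    ring
  have hright : ∀ q, pe ≤ q → q < 1 → γ q = A q - a := by
    intro q h1 h2
    rw [hγ' q ⟨by linarith, h2⟩, max_eq_left]
    rw [hA', div_right_comm L, div_mul_eq_mul_div]
    gcongr
    exact mul_four_div_sub_three_le hlam hL he0 heq h1 h2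
  have hAγ : A p - a ≤ γ p := by
    rw [hγ' p hp]
    gcongr
    exact le_max_left _ _
  rw [hright _ (le_max_left _ _) (max_lt he1 hpA.2)]
  rcases le_total pe pA with h | h
  · rw [max_eq_right h]
    linarith [hpAmin p hp]
  rw [max_eq_left h]
  rcases le_total pe p with hpp | hpp
  · refine le_trans (sub_le_sub_right ?_ a) hAγ
    have := hpAmin p hp
    rw [hA', hA'] at this ⊢
    exact div_add_div_one_sub_le_of_le ha0.le (by positivity) hpA.1 h hpp hp.2 this
  · have hp0 := hp.1
    have hcross : L / n / (1 - pe) = lam / n * (4 / pe - 3) := by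
      have := he0.ne'
      have := (sub_pos.2 he1).ne'
      field_simp
      linarith
    rw [hγ' p hp, hA', hcross]
    refine sub_le_sub_right (le_trans ?_ (le_max_right _ _)) a
    gcongr
end

section
/- Define C(p) = p(1−p)γ(p) for p ∈ (0,1), and p_A = 1 − Ln/(αλ²). Then p* := max{p_e, p_A} lies in (0,1) and minimizes C over (0,1): for every p ∈ (0,1), C(p*) ≤ C(p). -/
/-- The smaller root of `3 lam x² - (7 lam + L) x + 4 lam` lies in `(0, 1)`, and it is where the
line `L x` meets the parabola `lam (1 - x) (4 - 3 x)`. -/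
lemma crossing_point {lam L x : ℝ} (hlam : 0 < lam) (hL : 0 < L)
    (hx : x = (7 * lam + L - Real.sqrt (lam ^ 2 + 14 * lam * L + L ^ 2)) / (6 * lam)) :
    0 < x ∧ x < 1 ∧ L * x = lam * ((1 - x) * (4 - 3 * x)) := by
  have hLl : 0 < lam * L := mul_pos hlam hL
  have hD : 0 ≤ lam ^ 2 + 14 * lam * L + L ^ 2 := by positivity
  have hsq := Real.sq_sqrt hD
  have hs := Real.sqrt_nonneg (lam ^ 2 + 14 * lam * L + L ^ 2)
  set s := Real.sqrt (lam ^ 2 + 14 * lam * L + L ^ 2)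
  have hs_lt : s < 7 * lam + L := by nlinarith
  have lt_hs : lam + L < s := by nlinarith
  have hsx : s = 7 * lam + L - 6 * lam * x := by rw [hx]; field_simp; ring
  refine ⟨by rw [hx]; exact div_pos (by linarith) (by linarith),
    by rw [hx, div_lt_one (by linarith)]; linarith, ?_⟩
  rw [hsx] at hsq
  apply mul_left_cancel₀ hlam.ne'
  linarith

/-- If `e < 1` is a crossing point of `L x` and `lam (1 - x) (4 - 3 x)`, and `v` is the vertex
of `k (1 - x)² + L x`, then `max e v` minimizes
`k (1 - x)² + max (L x) (lam (1 - x) (4 - 3 x))` over all reals. -/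
lemma minimizer_of_crossing_point_of_vertex {lam L k e v p : ℝ} (hlam : 0 < lam) (hL : 0 < L)
    (hk : 0 < k) (he : e < 1) (hroot : L * e = lam * ((1 - e) * (4 - 3 * e)))
    (hv : 2 * k * (1 - v) = L) :
    k * (1 - max e v) ^ 2 + max (L * max e v) (lam * ((1 - max e v) * (4 - 3 * max e v)))
      ≤ k * (1 - p) ^ 2 + max (L * p) (lam * ((1 - p) * (4 - 3 * p))) := by
  have anti : ∀ x y : ℝ, x ≤ y → y ≤ 1 → (1 - y) * (4 - 3 * y) ≤ (1 - x) * (4 - 3 * x) :=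
    fun x y hxy hy => by nlinarith
  have v_lt : v < 1 := by
    have := pos_of_mul_pos_right (hv ▸ hL) (by positivity : 0 ≤ 2 * k)
    linarith
  have h_line : lam * ((1 - max e v) * (4 - 3 * max e v)) ≤ L * max e v :=
    calc _ ≤ lam * ((1 - e) * (4 - 3 * e)) :=
          mul_le_mul_of_nonneg_left (anti _ _ (le_max_left _ _) (max_lt he v_lt).le) hlam.le
      _ = L * e := hroot.symm
      _ ≤ L * max e v := mul_le_mul_of_nonneg_left (le_max_left _ _) hL.le
  rw [max_eq_left h_line]
  have h₁ := le_max_left (L * p) (lam * ((1 - p) * (4 - 3 * p)))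
  have h₂ := le_max_right (L * p) (lam * ((1 - p) * (4 - 3 * p)))
  rcases le_total e v with hev | hev
  · rw [max_eq_right hev]
    have key : k * (1 - p) ^ 2 + L * p - (k * (1 - v) ^ 2 + L * v) = k * (p - v) ^ 2 := by
      rw [← hv]; ring
    have : 0 ≤ k * (p - v) ^ 2 := by positivity
    linarith
  · rw [max_eq_left hev]
    rcases le_total e p with hep | hep
    · have key : k * (1 - p) ^ 2 + L * p - (k * (1 - e) ^ 2 + L * e)
          = k * ((p - e) * ((p - v) + (e - v))) := by
        rw [← hv]; ring
      have : 0 ≤ k * ((p - e) * ((p - v) + (e - v))) :=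
        mul_nonneg hk.le (mul_nonneg (by linarith) (by linarith))
      linarith
    · have h₃ := mul_le_mul_of_nonneg_left (anti p e hep he.le) hlam.le
      have h₄ : k * (1 - e) ^ 2 ≤ k * (1 - p) ^ 2 :=
        mul_le_mul_of_nonneg_left (pow_le_pow_left₀ (by linarith) (by linarith) 2) hk.le
      linarith

/-- **Theorem 5, optimal communication.**
Fix `λ > 0`, `L > 0`, `α > 0` and an integer `n ≥ 1`. With
`γ(p) = αλ²(1−p)/(2n²p) + max{ L/(n(1−p)), (λ/n)(1 + 4(1−p)/p) }`,
`C(p) = p(1−p)γ(p)`, `p_e = (7λ + L − √(λ² + 14λL + L²))/(6λ)` and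
`p_A = 1 − Ln/(αλ²)`, the point `p* = max{p_e, p_A}` lies in `(0,1)` and minimizes `C`
over `(0,1)`. -/
theorem stmt3 (lam L alpha : ℝ) (n : ℕ)
    (hlam : 0 < lam) (hL : 0 < L) (halpha : 0 < alpha) (hn : 1 ≤ n)
    (γ C : ℝ → ℝ)
    (hγ : ∀ p, γ p = alpha * lam ^ 2 * (1 - p) / (2 * (n : ℝ) ^ 2 * p)
        + max (L / (n * (1 - p))) (lam / n * (1 + 4 * (1 - p) / p)))
    (hC : ∀ p, C p = p * (1 - p) * γ p)
    (pe : ℝ)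
    (hpe : pe = (7 * lam + L - Real.sqrt (lam ^ 2 + 14 * lam * L + L ^ 2)) / (6 * lam))
    (pA : ℝ) (hpA : pA = 1 - L * n / (alpha * lam ^ 2)) :
    max pe pA ∈ Set.Ioo (0 : ℝ) 1 ∧
      ∀ p ∈ Set.Ioo (0 : ℝ) 1, C (max pe pA) ≤ C p := by
  have hn0 : (0 : ℝ) < n := by exact_mod_cast hn
  obtain ⟨pe_pos, pe_lt, hroot⟩ := crossing_point hlam hL hpe
  have pA_lt : pA < 1 := by
    rw [hpA]
    have : 0 < L * n / (alpha * lam ^ 2) := by positivity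
    linarith
  have hmem : max pe pA ∈ Set.Ioo (0 : ℝ) 1 := ⟨lt_max_of_lt_left pe_pos, max_lt pe_lt pA_lt⟩
  have C_eq : ∀ p ∈ Set.Ioo (0 : ℝ) 1, C p = (1 / n) * (alpha * lam ^ 2 / (2 * n) * (1 - p) ^ 2
      + max (L * p) (lam * ((1 - p) * (4 - 3 * p)))) := by
    rintro p ⟨hp0, hp1⟩
    have hq : 0 < 1 - p := sub_pos.mpr hp1
    rw [hC, hγ, mul_add (p * (1 - p)), mul_add (1 / (n : ℝ)),
      mul_max_of_nonneg _ _ (mul_pos hp0 hq).le,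
      mul_max_of_nonneg _ _ (by positivity : (0 : ℝ) ≤ 1 / n)]
    congr 1
    · field_simp
    · congr 1
      · field_simp
      · field_simp
        ring
  refine ⟨hmem, fun p hp => ?_⟩
  rw [C_eq _ hmem, C_eq p hp]
  refine mul_le_mul_of_nonneg_left ?_ (by positivity)
  refine minimizer_of_crossing_point_of_vertex hlam hL (by positivity) pe_lt hroot ?_
  rw [hpA]
  field_simp
  ring
end

section
/- With p_e = (7λ + L − √(λ² + 14λL + L²))/(6λ), one has p_e ∈ (0,1), 3λp_e² − (7λ + L)p_e + 4λ = 0, and A(p_e) = B(p_e). -/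
/-- Fix `λ > 0`, `L > 0`, `α > 0` and an integer `n ≥ 1`, and let
`A(p) = αλ²/(2n²p) + L/(n(1−p))`, `B(p) = αλ²/(2n²p) + 4λ/(np) − 3λ/n`.
With `p_e = (7λ + L − √(λ² + 14λL + L²))/(6λ)` one has `p_e ∈ (0,1)`,
`3λp_e² − (7λ + L)p_e + 4λ = 0`, and `A(p_e) = B(p_e)`. -/
theorem stmt5 (lam L alpha : ℝ) (n : ℕ)
    (hlam : 0 < lam) (hL : 0 < L) (halpha : 0 < alpha) (hn : 1 ≤ n)
    (A B : ℝ → ℝ)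
    (hA : ∀ p, A p = alpha * lam ^ 2 / (2 * (n : ℝ) ^ 2 * p) + L / (n * (1 - p)))
    (hB : ∀ p, B p = alpha * lam ^ 2 / (2 * (n : ℝ) ^ 2 * p) + 4 * lam / (n * p) - 3 * lam / n)
    (pe : ℝ)
    (hpe : pe = (7 * lam + L - Real.sqrt (lam ^ 2 + 14 * lam * L + L ^ 2)) / (6 * lam)) :
    pe ∈ Set.Ioo (0 : ℝ) 1 ∧
      3 * lam * pe ^ 2 - (7 * lam + L) * pe + 4 * lam = 0 ∧
      A pe = B pe := by
  have hn0 : (n : ℝ) ≠ 0 := by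
    have : 0 < n := hn
    positivity
  have hlamL : 0 < lam * L := mul_pos hlam hL
  set s := Real.sqrt (lam ^ 2 + 14 * lam * L + L ^ 2) with hs
  have hsq : s ^ 2 = lam ^ 2 + 14 * lam * L + L ^ 2 := Real.sq_sqrt (by positivity)
  have hs_lt : s < 7 * lam + L := by
    rw [hs, Real.sqrt_lt' (by positivity)]
    nlinarith [sq_pos_of_pos hlam]
  have lt_hs : lam + L < s := by
    rw [hs, Real.lt_sqrt (by positivity)]
    nlinarith
  have hpos : 0 < pe := by
    rw [hpe]
    exact div_pos (by linarith) (by positivity)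
  have hlt : pe < 1 := by
    rw [hpe, div_lt_one (by positivity)]
    linarith
  have hquad : 3 * lam * pe ^ 2 - (7 * lam + L) * pe + 4 * lam = 0 := by
    rw [hpe]
    field_simp
    linear_combination 3 * hsq
  refine ⟨⟨hpos, hlt⟩, hquad, ?_⟩
  have hpe0 : pe ≠ 0 := hpos.ne'
  have hpe1 : 1 - pe ≠ 0 := (sub_pos.2 hlt).ne'
  have hbranch : L / (n * (1 - pe)) = 4 * lam / (n * pe) - 3 * lam / n := by
    field_simp
    linear_combination -hquad
  rw [hA, hB, hbranch]
  ring
end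

section
/- Let {p_k}_{k=0}^{K} and {q_k}_{k=0}^{K} be non-negative real sequences, let a ≥ 0, c ≥ 0, b > 0 be constants, and let K ≥ 1 be an integer. If p_{k+1} ≤ (1 + a)p_k − b·q_k + c holds for all 0 ≤ k ≤ K − 1, then min_{k=0,1,…,K−1} q_k ≤ ((1 + a)^K/(bK))·p_0 + c/b. -/
/-- A sequence that grows by a factor of at most `1 + a` and loses `d ≥ 0` at each of `n` steps
satisfies `p n + n d ≤ (1 + a)^n p 0`. -/
theorem add_mul_le_one_add_pow_mul {p : ℕ → ℝ} {a d : ℝ} (ha : 0 ≤ a) (hd : 0 ≤ d) (n : ℕ)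
    (h : ∀ k < n, p (k + 1) ≤ (1 + a) * p k - d) :
    p n + n * d ≤ (1 + a) ^ n * p 0 := by
  induction n with
  | zero => simp
  | succ n ih =>
    have hstep := h n n.lt_succ_self
    have hprev := mul_le_mul_of_nonneg_left (ih fun k hk => h k (hk.trans n.lt_succ_self))
      (by positivity : 0 ≤ 1 + a)
    have hand : 0 ≤ a * (n * d) := by positivity
    rw [pow_succ']
    push_cast
    linarith

/-- **Lemma 9, recursion lemma.**
If the non-negative sequences `p, q` satisfy `p_{k+1} ≤ (1 + a)p_k − b q_k + c` for
`0 ≤ k ≤ K − 1` (with `a ≥ 0`, `b > 0`, `c ≥ 0`, `K ≥ 1`), then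
`min_{0 ≤ k ≤ K−1} q_k ≤ ((1 + a)^K/(bK)) p_0 + c/b`. -/
theorem stmt6 (K : ℕ) (hK : 1 ≤ K) (p q : ℕ → ℝ)
    (hp : ∀ k ≤ K, 0 ≤ p k) (hq : ∀ k ≤ K, 0 ≤ q k)
    (a b c : ℝ) (ha : 0 ≤ a) (hb : 0 < b) (hc : 0 ≤ c)
    (hrec : ∀ k < K, p (k + 1) ≤ (1 + a) * p k - b * q k + c) :
    (Finset.range K).inf' (Finset.nonempty_range_iff.mpr (Nat.one_le_iff_ne_zero.mp hK)) q ≤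
      (1 + a) ^ K / (b * K) * p 0 + c / b := by
  set m := (Finset.range K).inf' (Finset.nonempty_range_iff.mpr (Nat.one_le_iff_ne_zero.mp hK)) q
  have hm : ∀ k < K, m ≤ q k := fun k hk => Finset.inf'_le q (Finset.mem_range.mpr hk)
  have hK0 : (0 : ℝ) < K := by exact_mod_cast hK
  have hp0 := hp 0 K.zero_le
  rcases le_total (b * m) c with hmc | hmc
  · have hmle : m ≤ c / b := (le_div_iff₀' hb).mpr hmc
    have hfirst : 0 ≤ (1 + a) ^ K / (b * K) * p 0 := by positivity
    linarith
  · have hsum := add_mul_le_one_add_pow_mul (p := p) ha (sub_nonneg.mpr hmc) K fun k hk => by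
      linarith [hrec k hk, mul_le_mul_of_nonneg_left (hm k hk) hb.le]
    have hpK := hp K le_rfl
    have heq : (1 + a) ^ K / (b * K) * p 0 + c / b = ((1 + a) ^ K * p 0 + K * c) / (b * K) := by
      field_simp
    rw [heq, le_div_iff₀ (by positivity)]
    linarith
end

section
/- Fix p ∈ (0,1), λ > 0, and x = (x_1,…,x_n) ∈ (ℝ^d)^n with average x̄ = (1/n)Σ_i x_i, and assume each f_i : ℝ^d → ℝ is differentiable at x_i. Let Z be an integrable ℝ^d-valued random vector on a probability space (Ω, μ) with E[Z] = x̄, and let ξ be a {0,1}-valued random variable with P(ξ = 1) = p defined on an independent probability space, the joint law being the product measure. Define the random vector G ∈ (ℝ^d)^n blockwise by G_i = ∇f_i(x_i)/(n(1 − p)) if ξ = 0 and G_i = (λ/(np))(x_i − Z) if ξ = 1. Then for every i = 1,…,n: E[G_i] = (1/n)∇f_i(x_i) + (λ/n)(x_i − x̄). -/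
open MeasureTheory

/-- Integral of a function on a product which depends only on the first coordinate, the choice of
the function being made according to whether the second coordinate lies in `S`. -/
theorem integral_prod_piecewise_snd {α β E : Type*} [MeasurableSpace α] [MeasurableSpace β]
    [NormedAddCommGroup E] [NormedSpace ℝ E] {μ : Measure α} {ν : Measure β}
    [SFinite μ] [IsFiniteMeasure ν] {S : Set β} [DecidablePred (· ∈ S)]
    (hS : MeasurableSet S) {g h : α → E} (hg : Integrable g μ) (hh : Integrable h μ) :
    ∫ w, (if w.2 ∈ S then g w.1 else h w.1) ∂(μ.prod ν) =
      ν.real S • ∫ a, g a ∂μ + ν.real Sᶜ • ∫ a, h a ∂μ := by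
  classical
  have restrict_snd (T : Set β) :
      (μ.prod ν).restrict (Prod.snd ⁻¹' T) = μ.prod (ν.restrict T) := by
    rw [← Set.univ_prod, ← Measure.prod_restrict, Measure.restrict_univ]
  have key := integral_piecewise (measurable_snd hS)
    (hg.comp_fst ν).integrableOn (hh.comp_fst ν).integrableOn
  rw [← Set.preimage_compl, restrict_snd, restrict_snd, integral_fun_fst, integral_fun_fst,
    measureReal_restrict_apply_univ, measureReal_restrict_apply_univ] at key
  rw [← key]
  congr 1 with w
  simp only [Set.piecewise, Set.mem_preimage]

/-- **Lemma 3, unbiasedness of the L2GD stochastic gradient.**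
Fix `p ∈ (0,1)`, `λ > 0`, `x = (x_1,…,x_n) ∈ (ℝ^d)^n` with average `x̄`, and `f_i`
differentiable at `x_i`. Let `Z` be integrable with `E[Z] = x̄` and `ξ` a Bernoulli(`p`)
variable on an independent space.  If `G_i = ∇f_i(x_i)/(n(1−p))` when `ξ = 0` and
`G_i = (λ/(np))(x_i − Z)` when `ξ = 1`, then
`E[G_i] = (1/n)∇f_i(x_i) + (λ/n)(x_i − x̄)` for every `i`. -/
theorem stmt10 {n d : ℕ} (hn : 1 ≤ n) (p lam : ℝ)
    (hp : p ∈ Set.Ioo (0 : ℝ) 1) (hlam : 0 < lam)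
    (f : Fin n → EuclideanSpace ℝ (Fin d) → ℝ)
    (x : Fin n → EuclideanSpace ℝ (Fin d))
    (hdiff : ∀ i, DifferentiableAt ℝ (f i) (x i))
    {Ω Ω' : Type*} [MeasurableSpace Ω] [MeasurableSpace Ω']
    (μ : Measure Ω) (μ' : Measure Ω')
    [IsProbabilityMeasure μ] [IsProbabilityMeasure μ']
    (Z : Ω → EuclideanSpace ℝ (Fin d)) (hZint : Integrable Z μ)
    (hZmean : ∫ ω, Z ω ∂μ = (n : ℝ)⁻¹ • ∑ i, x i)
    (ξ : Ω' → Bool) (hξmeas : Measurable ξ)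
    (hξ : μ' {ω' | ξ ω' = true} = ENNReal.ofReal p)
    (G : Fin n → Ω × Ω' → EuclideanSpace ℝ (Fin d))
    (hG : ∀ i w, G i w =
      if ξ w.2 = false then ((n : ℝ) * (1 - p))⁻¹ • gradient (f i) (x i)
      else (lam / ((n : ℝ) * p)) • (x i - Z w.1)) :
    ∀ i, ∫ w, G i w ∂(μ.prod μ') =
      (n : ℝ)⁻¹ • gradient (f i) (x i) +
        (lam / n) • (x i - (n : ℝ)⁻¹ • ∑ j, x j) := by
  intro i
  obtain ⟨hp0, hp1⟩ := hp
  have hS : MeasurableSet {ω' | ξ ω' = true} := hξmeas (measurableSet_singleton true)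
  have hSreal : μ'.real {ω' | ξ ω' = true} = p := by
    rw [measureReal_def, hξ, ENNReal.toReal_ofReal hp0.le]
  have hGi : G i = fun w => if w.2 ∈ {ω' | ξ ω' = true}
      then (lam / ((n : ℝ) * p)) • (x i - Z w.1)
      else ((n : ℝ) * (1 - p))⁻¹ • gradient (f i) (x i) := by
    funext w
    rw [hG]
    by_cases h : ξ w.2 = true <;> simp [h]
  have hn0 : (n : ℝ) ≠ 0 := by positivity
  have hq0 : 1 - p ≠ 0 := (sub_pos.2 hp1).ne'
  rw [hGi, integral_prod_piecewise_snd (g := fun ω => (lam / ((n : ℝ) * p)) • (x i - Z ω))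
      (h := fun _ => ((n : ℝ) * (1 - p))⁻¹ • gradient (f i) (x i)) hS
      (((integrable_const (x i)).sub hZint).smul (lam / ((n : ℝ) * p))) (integrable_const _),
    probReal_compl_eq_one_sub hS, hSreal, integral_smul,
    integral_sub (integrable_const _) hZint, hZmean, integral_const, integral_const,
    probReal_univ, one_smul, one_smul, smul_smul, smul_smul, add_comm]
  congr 2 <;> field_simp
end
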